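/- Let (A, L) be a random financial network and b > 0, and assume ρ_b(A, L) > 0. Then for every optimal allocation Y* (i.e. Y* ∈ 𝒞 with Σ_{i=1}^N Y*_i = ρ_b(A, L) ℙ-a.s. and η(Λ(A+Y*, L)) ≤ b), the risk constraint is binding: η(Λ(A+Y*, L)) = b. -/

import Mathlib

open MeasureTheory

/-- Total liability vector: `ℓ̄_i = ∑_j ℓ_{ij}`. -/
noncomputable def lbar {N : ℕ} (ℓ : Fin N → Fin N → ℝ) : Fin N → ℝ := fun i => ∑ j, ℓ i j

/-- Relative liability matrix: `π_{ij} = ℓ_{ij}/ℓ̄_i` if `ℓ̄_i > 0`, else `0`. -/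
noncomputable def relPi {N : ℕ} (ℓ : Fin N → Fin N → ℝ) : Fin N → Fin N → ℝ :=
  fun i j => if 0 < lbar ℓ i then ℓ i j / lbar ℓ i else 0

/-- The Eisenberg–Noe clearing map `Φ(p, a, π, ℓ̄) = (πᵀp + a) ∧ ℓ̄`. -/
noncomputable def Phi {N : ℕ} (π : Fin N → Fin N → ℝ) (a lb p : Fin N → ℝ) : Fin N → ℝ :=
  fun i => min ((∑ j, π j i * p j) + a i) (lb i)

/-- The clearing vector `CV(a, ℓ)`: the (for `a ∈ ℝ^N_{++}` unique) nonnegative fixed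
point of the clearing map associated with the liability matrix `ℓ`. -/
noncomputable def clearingVec {N : ℕ} (a : Fin N → ℝ) (ℓ : Fin N → Fin N → ℝ) : Fin N → ℝ :=
  Classical.epsilon fun p => (∀ i, 0 ≤ p i) ∧ Phi (relPi ℓ) a (lbar ℓ) p = p

/-- The Eisenberg–Noe aggregation function `Λ(a, ℓ) = ∑_i (ℓ̄_i − CV_i(a, ℓ))`. -/
noncomputable def aggLoss {N : ℕ} (a : Fin N → ℝ) (ℓ : Fin N → Fin N → ℝ) : ℝ :=
  ∑ i, (lbar ℓ i - clearingVec a ℓ i)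

/-- The feasible total bailout-capital levels: constants `c` such that some admissible
random allocation `Y ∈ 𝒞` with `∑ᵢ Yᵢ = c` a.s. makes the system acceptable. -/
noncomputable def feas {Ω : Type*} [MeasurableSpace Ω] (P : Measure Ω) {N : ℕ}
    (η : (Ω → ℝ) → ℝ) (A : Ω → Fin N → ℝ) (L : Ω → Fin N → Fin N → ℝ) (b : ℝ) : Set ℝ :=
  {c : ℝ | ∃ Y : Ω → Fin N → ℝ, Measurable Y ∧ (∀ ω i, 0 ≤ Y ω i) ∧
    (∀ᵐ ω ∂P, ∑ i, Y ω i = c) ∧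
    η (fun ω => aggLoss (fun i => A ω i + Y ω i) (L ω)) ≤ b}

/-- The systemic risk measure `ρ_b(A, L)`. -/
noncomputable def sysRisk {Ω : Type*} [MeasurableSpace Ω] (P : Measure Ω) {N : ℕ}
    (η : (Ω → ℝ) → ℝ) (A : Ω → Fin N → ℝ) (L : Ω → Fin N → Fin N → ℝ) (b : ℝ) : ℝ :=
  sInf (feas P η A L b)

open Filter Topology

theorem lbar_nonneg {N : ℕ} {ℓ : Fin N → Fin N → ℝ} (hℓ : ∀ i j, 0 ≤ ℓ i j) (i : Fin N) :
    0 ≤ lbar ℓ i :=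
  Finset.sum_nonneg fun j _ => hℓ i j

theorem relPi_nonneg {N : ℕ} {ℓ : Fin N → Fin N → ℝ} (hℓ : ∀ i j, 0 ≤ ℓ i j) (i j : Fin N) :
    0 ≤ relPi ℓ i j := by
  unfold relPi
  split_ifs with h
  · exact div_nonneg (hℓ i j) h.le
  · exact le_rfl

theorem Phi_monotone {N : ℕ} {π : Fin N → Fin N → ℝ} (hπ : ∀ i j, 0 ≤ π i j)
    (a lb : Fin N → ℝ) : Monotone (Phi π a lb) := by
  intro p q hpq i
  have h : ∑ j, π j i * p j ≤ ∑ j, π j i * q j :=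
    Finset.sum_le_sum fun j _ => mul_le_mul_of_nonneg_left (hpq j) (hπ j i)
  exact min_le_min (by linarith) le_rfl

theorem Phi_continuous {N : ℕ} (π : Fin N → Fin N → ℝ) (a lb : Fin N → ℝ) :
    Continuous (Phi π a lb) := by
  unfold Phi
  fun_prop

/-- Comparison principle: a subsolution of the clearing equation lies below every
nonnegative fixed point, as soon as all operating cash flows are positive. -/
theorem le_of_le_Phi {N : ℕ} {π : Fin N → Fin N → ℝ} (hπ : ∀ i j, 0 ≤ π i j)
    {a lb p q : Fin N → ℝ} (ha : ∀ i, 0 < a i)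
    (hp : ∀ i, 0 ≤ p i) (hfix : Phi π a lb p = p) (hq : q ≤ Phi π a lb q) : q ≤ p := by
  classical
  by_contra hne
  obtain ⟨k, hk⟩ : ∃ k, p k < q k := by simpa [Pi.le_def] using hne
  obtain ⟨i, hi, hmin⟩ := (Finset.univ.filter fun i => 0 < q i).exists_min_image
    (fun i => p i / q i) ⟨k, by simpa using (hp k).trans_lt hk⟩
  have hqi : 0 < q i := by simpa using hi
  set s := p i / q i with hs
  have hs0 : 0 ≤ s := div_nonneg (hp i) hqi.le
  have hs1 : s < 1 := by
    have hqk := (hp k).trans_lt hk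
    exact (hmin k (by simpa using hqk)).trans_lt ((div_lt_one hqk).2 hk)
  have hsq : ∀ j, s * q j ≤ p j := by
    intro j
    by_cases hj : 0 < q j
    · exact (le_div_iff₀ hj).1 (hmin j (by simpa using hj))
    · exact (mul_nonpos_of_nonneg_of_nonpos hs0 (not_lt.1 hj)).trans (hp j)
  have hpi : p i = s * q i := by rw [hs]; field_simp
  have hsum : s * ∑ j, π j i * q j ≤ ∑ j, π j i * p j := by
    rw [Finset.mul_sum]
    refine Finset.sum_le_sum fun j _ => ?_
    calc s * (π j i * q j) = π j i * (s * q j) := by ring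
      _ ≤ π j i * p j := mul_le_mul_of_nonneg_left (hsq j) (hπ j i)
  have hq1 : q i ≤ (∑ j, π j i * q j) + a i := (hq i).trans (min_le_left _ _)
  have hq2 : q i ≤ lb i := (hq i).trans (min_le_right _ _)
  have hlt : s * q i < p i := by
    rw [← congrFun hfix i]
    refine lt_min ?_ ?_
    · have h1 := mul_le_mul_of_nonneg_left hq1 hs0
      have h2 : s * a i < a i := mul_lt_of_lt_one_left (ha i) hs1
      linarith
    · exact (mul_lt_of_lt_one_left hqi hs1).trans_le hq2
  exact hlt.ne' hpi

/-- Fictitious clearing payments after `n` rounds, starting from zero payments. -/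
noncomputable def clearingIter {N : ℕ} (a : Fin N → ℝ) (ℓ : Fin N → Fin N → ℝ) (n : ℕ) :
    Fin N → ℝ :=
  (Phi (relPi ℓ) a (lbar ℓ))^[n] 0

theorem clearingIter_succ {N : ℕ} (a : Fin N → ℝ) (ℓ : Fin N → Fin N → ℝ) (n : ℕ) :
    clearingIter a ℓ (n + 1) = Phi (relPi ℓ) a (lbar ℓ) (clearingIter a ℓ n) :=
  Function.iterate_succ_apply' _ _ _

theorem exists_tendsto_clearingIter {N : ℕ} {a : Fin N → ℝ} {ℓ : Fin N → Fin N → ℝ}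
    (ha : ∀ i, 0 < a i) (hℓ : ∀ i j, 0 ≤ ℓ i j) :
    ∃ p : Fin N → ℝ, Tendsto (clearingIter a ℓ) atTop (𝓝 p) ∧
      (∀ i, 0 ≤ p i) ∧ Phi (relPi ℓ) a (lbar ℓ) p = p := by
  have hmono : Monotone (clearingIter a ℓ) := by
    refine (Phi_monotone (relPi_nonneg hℓ) a (lbar ℓ)).monotone_iterate_of_le_map ?_
    intro i
    simpa [Phi] using ⟨(ha i).le, lbar_nonneg hℓ i⟩
  have hbdd : ∀ n i, clearingIter a ℓ n i ≤ lbar ℓ i := by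
    intro n i
    cases n with
    | zero => exact lbar_nonneg hℓ i
    | succ n => rw [clearingIter_succ]; exact min_le_right _ _
  have hlim : ∀ i, Tendsto (fun n => clearingIter a ℓ n i) atTop
      (𝓝 (⨆ n, clearingIter a ℓ n i)) := fun i =>
    tendsto_atTop_ciSup (fun m n h => hmono h i)
      ⟨lbar ℓ i, by rintro _ ⟨n, rfl⟩; exact hbdd n i⟩
  have hlim' : Tendsto (clearingIter a ℓ) atTop (𝓝 fun i => ⨆ n, clearingIter a ℓ n i) :=
    tendsto_pi_nhds.2 hlim
  refine ⟨_, hlim', fun i => ?_, ?_⟩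
  · exact ge_of_tendsto' (hlim i) fun n => hmono (Nat.zero_le n) i
  · exact isFixedPt_of_tendsto_iterate hlim' (Phi_continuous _ _ _).continuousAt

theorem clearingVec_spec {N : ℕ} {a : Fin N → ℝ} {ℓ : Fin N → Fin N → ℝ}
    (ha : ∀ i, 0 < a i) (hℓ : ∀ i j, 0 ≤ ℓ i j) :
    (∀ i, 0 ≤ clearingVec a ℓ i) ∧
      Phi (relPi ℓ) a (lbar ℓ) (clearingVec a ℓ) = clearingVec a ℓ := by
  obtain ⟨p, -, hp⟩ := exists_tendsto_clearingIter ha hℓ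
  exact Classical.epsilon_spec (p := fun p : Fin N → ℝ =>
    (∀ i, 0 ≤ p i) ∧ Phi (relPi ℓ) a (lbar ℓ) p = p) ⟨p, hp⟩

theorem clearingVec_le_lbar {N : ℕ} {a : Fin N → ℝ} {ℓ : Fin N → Fin N → ℝ}
    (ha : ∀ i, 0 < a i) (hℓ : ∀ i j, 0 ≤ ℓ i j) (i : Fin N) :
    clearingVec a ℓ i ≤ lbar ℓ i := by
  rw [← (clearingVec_spec ha hℓ).2]
  exact min_le_right _ _

theorem le_clearingVec {N : ℕ} {a q : Fin N → ℝ} {ℓ : Fin N → Fin N → ℝ}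
    (ha : ∀ i, 0 < a i) (hℓ : ∀ i j, 0 ≤ ℓ i j) (hq : q ≤ Phi (relPi ℓ) a (lbar ℓ) q) :
    q ≤ clearingVec a ℓ :=
  le_of_le_Phi (relPi_nonneg hℓ) ha (clearingVec_spec ha hℓ).1 (clearingVec_spec ha hℓ).2 hq

theorem tendsto_clearingIter {N : ℕ} {a : Fin N → ℝ} {ℓ : Fin N → Fin N → ℝ}
    (ha : ∀ i, 0 < a i) (hℓ : ∀ i j, 0 ≤ ℓ i j) :
    Tendsto (clearingIter a ℓ) atTop (𝓝 (clearingVec a ℓ)) := by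
  obtain ⟨p, hlim, hp, hfix⟩ := exists_tendsto_clearingIter ha hℓ
  have hcv := clearingVec_spec ha hℓ
  rwa [le_antisymm (le_of_le_Phi (relPi_nonneg hℓ) ha hp hfix hcv.2.ge)
    (le_clearingVec ha hℓ hfix.ge)]

/-- Scaling down the injected capital by `t ∈ [0, 1]` scales payments down at most by `t`. -/
theorem smul_clearingVec_le {N : ℕ} {a y : Fin N → ℝ} {ℓ : Fin N → Fin N → ℝ}
    (ha : ∀ i, 0 < a i) (hy : ∀ i, 0 ≤ y i) (hℓ : ∀ i j, 0 ≤ ℓ i j) {t : ℝ}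
    (ht0 : 0 ≤ t) (ht1 : t ≤ 1) (i : Fin N) :
    t * clearingVec (fun i => a i + y i) ℓ i ≤ clearingVec (fun i => a i + t * y i) ℓ i := by
  have hay : ∀ i, 0 < a i + y i := fun i => add_pos_of_pos_of_nonneg (ha i) (hy i)
  have haty : ∀ i, 0 < a i + t * y i := fun i =>
    add_pos_of_pos_of_nonneg (ha i) (mul_nonneg ht0 (hy i))
  obtain ⟨hp, hfix⟩ := clearingVec_spec hay hℓ
  set p := clearingVec (fun i => a i + y i) ℓ
  refine le_clearingVec (q := fun i => t * p i) haty hℓ (fun i => ?_) i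
  have h1 : p i ≤ (∑ j, relPi ℓ j i * p j) + (a i + y i) :=
    (congrFun hfix i).ge.trans (min_le_left _ _)
  have h2 : p i ≤ lbar ℓ i := clearingVec_le_lbar hay hℓ i
  have hsum : ∑ j, relPi ℓ j i * (t * p j) = t * ∑ j, relPi ℓ j i * p j := by
    rw [Finset.mul_sum]
    exact Finset.sum_congr rfl fun j _ => by ring
  refine le_min ?_ ((mul_le_of_le_one_left (hp i) ht1).trans h2)
  have h3 := mul_le_mul_of_nonneg_left h1 ht0
  have h4 : t * a i ≤ a i := mul_le_of_le_one_left (ha i).le ht1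
  simp only [hsum]
  linarith

theorem aggLoss_nonneg {N : ℕ} {a : Fin N → ℝ} {ℓ : Fin N → Fin N → ℝ}
    (ha : ∀ i, 0 < a i) (hℓ : ∀ i j, 0 ≤ ℓ i j) : 0 ≤ aggLoss a ℓ :=
  Finset.sum_nonneg fun i _ => sub_nonneg.2 (clearingVec_le_lbar ha hℓ i)

theorem aggLoss_le {N : ℕ} {a : Fin N → ℝ} {ℓ : Fin N → Fin N → ℝ}
    (ha : ∀ i, 0 < a i) (hℓ : ∀ i j, 0 ≤ ℓ i j) : aggLoss a ℓ ≤ ∑ i, lbar ℓ i :=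
  Finset.sum_le_sum fun i _ => sub_le_self _ ((clearingVec_spec ha hℓ).1 i)

theorem aggLoss_scale_le {N : ℕ} {a y : Fin N → ℝ} {ℓ : Fin N → Fin N → ℝ}
    (ha : ∀ i, 0 < a i) (hy : ∀ i, 0 ≤ y i) (hℓ : ∀ i j, 0 ≤ ℓ i j) {s : ℝ}
    (hs0 : 0 ≤ s) (hs1 : s ≤ 1) :
    aggLoss (fun i => a i + (1 - s) * y i) ℓ
      ≤ aggLoss (fun i => a i + y i) ℓ + s * ∑ i, lbar ℓ i := by
  unfold aggLoss
  rw [Finset.mul_sum, ← Finset.sum_add_distrib]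
  refine Finset.sum_le_sum fun i _ => ?_
  have h1 := smul_clearingVec_le ha hy hℓ (t := 1 - s) (by linarith) (by linarith) i
  have h2 := mul_le_mul_of_nonneg_left
    (clearingVec_le_lbar (fun i => add_pos_of_pos_of_nonneg (ha i) (hy i)) hℓ i) hs0
  linarith

section Measurability

variable {Ω : Type*} [MeasurableSpace Ω] {N : ℕ} {B : Ω → Fin N → ℝ} {L : Ω → Fin N → Fin N → ℝ}

theorem measurable_lbar (hL : Measurable L) : Measurable fun ω => lbar (L ω) := by
  unfold lbar
  fun_prop

theorem measurable_relPi (hL : Measurable L) : Measurable fun ω => relPi (L ω) := by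
  have hl := measurable_lbar hL
  refine measurable_pi_lambda _ fun i => measurable_pi_lambda _ fun j => ?_
  refine Measurable.ite (measurableSet_lt measurable_const (by fun_prop)) ?_ measurable_const
  fun_prop

theorem measurable_clearingIter (hB : Measurable B) (hL : Measurable L) (n : ℕ) :
    Measurable fun ω => clearingIter (B ω) (L ω) n := by
  induction n with
  | zero => exact measurable_const
  | succ n ih =>
    have hl := measurable_lbar hL
    have hπ := measurable_relPi hL
    simp only [clearingIter_succ]
    unfold Phi
    fun_prop

theorem measurable_aggLoss (hB : Measurable B) (hBpos : ∀ ω i, 0 < B ω i)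
    (hL : Measurable L) (hLnn : ∀ ω i j, 0 ≤ L ω i j) :
    Measurable fun ω => aggLoss (B ω) (L ω) := by
  have hl := measurable_lbar hL
  have hcv : Measurable fun ω => clearingVec (B ω) (L ω) :=
    measurable_of_tendsto_metrizable (measurable_clearingIter hB hL)
      (tendsto_pi_nhds.2 fun ω => tendsto_clearingIter (hBpos ω) (hLnn ω))
  unfold aggLoss
  fun_prop

theorem integrable_aggLoss {P : Measure Ω} (hB : Measurable B) (hBpos : ∀ ω i, 0 < B ω i)
    (hL : Measurable L) (hLnn : ∀ ω i j, 0 ≤ L ω i j)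
    (hLint : Integrable (fun ω => ∑ i, lbar (L ω) i) P) :
    Integrable (fun ω => aggLoss (B ω) (L ω)) P :=
  hLint.mono' (measurable_aggLoss hB hBpos hL hLnn).aestronglyMeasurable <|
    Eventually.of_forall fun ω => by
      rw [Real.norm_of_nonneg (aggLoss_nonneg (hBpos ω) (hLnn ω))]
      exact aggLoss_le (hBpos ω) (hLnn ω)

theorem bddBelow_feas (P : Measure Ω) [IsProbabilityMeasure P] (η : (Ω → ℝ) → ℝ)
    (A : Ω → Fin N → ℝ) (L : Ω → Fin N → Fin N → ℝ) (b : ℝ) : BddBelow (feas P η A L b) := by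
  refine ⟨0, ?_⟩
  rintro c ⟨Y, -, hY0, hYc, -⟩
  obtain ⟨ω, hω⟩ := hYc.exists
  exact hω ▸ Finset.sum_nonneg fun i _ => hY0 ω i

end Measurability

/-- If `ρ_b(A, L) > 0`, then for every optimal allocation `Y*` the risk
constraint is binding: `η(Λ(A+Y*, L)) = b`. -/
theorem sysRisk_constraint_binding
    {Ω : Type*} [MeasurableSpace Ω] (P : Measure Ω) [IsProbabilityMeasure P]
    (N : ℕ) (hN : 1 ≤ N)
    (η : (Ω → ℝ) → ℝ)
    (hη_mono : ∀ X Y : Ω → ℝ, Integrable X P → Integrable Y P →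
      (∀ᵐ ω ∂P, X ω ≤ Y ω) → η X ≤ η Y)
    (hη_conv : ∀ X Y : Ω → ℝ, Integrable X P → Integrable Y P → ∀ t : ℝ, 0 ≤ t → t ≤ 1 →
      η (fun ω => t * X ω + (1 - t) * Y ω) ≤ t * η X + (1 - t) * η Y)
    (hη_norm : η (fun _ => 0) = 0)
    (hη_cont : ∀ ε : ℝ, 0 < ε → ∃ δ : ℝ, 0 < δ ∧ ∀ X Y : Ω → ℝ,
      Integrable X P → Integrable Y P → (∫ ω, |X ω - Y ω| ∂P) < δ → |η X - η Y| < ε)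
    (A : Ω → Fin N → ℝ) (hA : Measurable A) (hApos : ∀ ω i, 0 < A ω i)
    (L : Ω → Fin N → Fin N → ℝ) (hL : Measurable L)
    (hLnn : ∀ ω i j, 0 ≤ L ω i j) (hLdiag : ∀ ω i, L ω i i = 0)
    (hLint : Integrable (fun ω => ∑ i, ∑ j, L ω i j) P)
    (b : ℝ) (hb : 0 < b)
    (hpos : 0 < sysRisk P η A L b) :
    ∀ Y : Ω → Fin N → ℝ, Measurable Y → (∀ ω i, 0 ≤ Y ω i) →
      (∀ᵐ ω ∂P, ∑ i, Y ω i = sysRisk P η A L b) →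
      η (fun ω => aggLoss (fun i => A ω i + Y ω i) (L ω)) ≤ b →
      η (fun ω => aggLoss (fun i => A ω i + Y ω i) (L ω)) = b := by
  intro Y hY hY0 hYsum hYb
  by_contra hne
  have hlt := lt_of_le_of_ne hYb hne
  replace hLint : Integrable (fun ω => ∑ i, lbar (L ω) i) P := hLint
  obtain ⟨δ, hδ, hcont⟩ := hη_cont _ (sub_pos.2 hlt)
  set E := ∫ ω, ∑ i, lbar (L ω) i ∂P with hE
  have hS0 : ∀ ω, 0 ≤ ∑ i, lbar (L ω) i := fun ω =>
    Finset.sum_nonneg fun i _ => lbar_nonneg (hLnn ω) i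
  have hE0 : 0 ≤ E := integral_nonneg hS0
  obtain ⟨s, hs0, hs1, hsE⟩ : ∃ s : ℝ, 0 < s ∧ s ≤ 1 ∧ s * E < δ := by
    refine ⟨δ / (E + δ), by positivity, (div_le_one (by positivity)).2 (by linarith), ?_⟩
    rw [div_mul_eq_mul_div, div_lt_iff₀ (by positivity)]
    nlinarith [mul_pos hδ hδ]
  have hint := integrable_aggLoss (P := P) (B := fun ω i => A ω i + Y ω i) (by fun_prop)
    (fun ω i => add_pos_of_pos_of_nonneg (hApos ω i) (hY0 ω i)) hL hLnn hLint
  have hsY0 : ∀ ω i, 0 ≤ (1 - s) * Y ω i := fun ω i =>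
    mul_nonneg (sub_nonneg.2 hs1) (hY0 ω i)
  have hint' := integrable_aggLoss (P := P) (B := fun ω i => A ω i + (1 - s) * Y ω i)
    (by fun_prop) (fun ω i => add_pos_of_pos_of_nonneg (hApos ω i) (hsY0 ω i)) hL hLnn hLint
  have hup := hint.add (hLint.const_mul s)
  have hle := hη_mono _ _ hint' hup <| Eventually.of_forall fun ω =>
    aggLoss_scale_le (hApos ω) (hY0 ω) (hLnn ω) hs0.le hs1
  have hclose := hcont _ _ hup hint <| by
    simpa [abs_of_nonneg hs0.le, abs_of_nonneg (hS0 _), abs_mul, integral_const_mul, ← hE]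
      using hsE
  have hmem : (1 - s) * sysRisk P η A L b ∈ feas P η A L b := by
    refine ⟨fun ω i => (1 - s) * Y ω i, by fun_prop, hsY0, ?_, ?_⟩
    · filter_upwards [hYsum] with ω hω
      rw [← Finset.mul_sum, hω]
    · linarith [(abs_lt.1 hclose).2]
  have hinf : sysRisk P η A L b ≤ _ := csInf_le (bddBelow_feas P η A L b) hmem
  nlinarith [mul_pos hs0 hpos]
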